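/- Let (L,T,R) be a strict Girard quantum triad, and assume T is distributive, i.e. (a ∨ c) ∧ (b ∨ c) = a·b ∨ c for all a, b, c ∈ T. Then Q₁ is distributive: for every q ∈ Q₁, r ∈ R, and l ∈ L, the equality (⟨r,⊤_L⟩ ∨ q) ∧ (⟨⊤_R,l⟩ ∨ q) = ⟨r,l⟩ ∨ q holds in the complete lattice Q₁, where joins and meets are componentwise pointwise. -/

import Mathlib

/-- A quantum triad `(L,T,R)`: a quantale `T`, a left `T`-module `L`,
a right `T`-module `R`, and a pairing `L × R → T`, all bimorphisms
(preserving arbitrary suprema in each variable) and satisfying the five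
associative laws (TTT, TTL, RTT, LRT, TLR). -/
structure Triad (L T R : Type*)
    [CompleteLattice L] [CompleteLattice T] [CompleteLattice R] where
  tmul : T → T → T
  smulL : T → L → L
  smulR : R → T → R
  pair : L → R → T
  tmul_sSup_left : ∀ (s : Set T) (b : T), tmul (sSup s) b = ⨆ a ∈ s, tmul a b
  tmul_sSup_right : ∀ (a : T) (s : Set T), tmul a (sSup s) = ⨆ b ∈ s, tmul a b
  smulL_sSup_left : ∀ (s : Set T) (l : L), smulL (sSup s) l = ⨆ t ∈ s, smulL t l
  smulL_sSup_right : ∀ (t : T) (s : Set L), smulL t (sSup s) = ⨆ l ∈ s, smulL t l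
  smulR_sSup_left : ∀ (s : Set R) (t : T), smulR (sSup s) t = ⨆ r ∈ s, smulR r t
  smulR_sSup_right : ∀ (r : R) (s : Set T), smulR r (sSup s) = ⨆ t ∈ s, smulR r t
  pair_sSup_left : ∀ (s : Set L) (r : R), pair (sSup s) r = ⨆ l ∈ s, pair l r
  pair_sSup_right : ∀ (l : L) (s : Set R), pair l (sSup s) = ⨆ r ∈ s, pair l r
  tmul_assoc : ∀ a b c : T, tmul (tmul a b) c = tmul a (tmul b c)
  smulL_assoc : ∀ (t t' : T) (l : L), smulL (tmul t t') l = smulL t (smulL t' l)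
  smulR_assoc : ∀ (r : R) (t t' : T), smulR (smulR r t) t' = smulR r (tmul t t')
  pair_smulR : ∀ (l : L) (r : R) (t : T), tmul (pair l r) t = pair l (smulR r t)
  smulL_pair : ∀ (t : T) (l : L) (r : R), pair (smulL t l) r = tmul t (pair l r)

variable {L T R : Type*} [CompleteLattice L] [CompleteLattice T] [CompleteLattice R]

/-- `Q₁`: pairs `(α,β)` of suprema-preserving `T`-equivariant endomaps of `L`
resp. `R` satisfying `α(l)·r = l·β(r)`. -/
def Triad.Q1 (τ : Triad L T R) : Set ((L → L) × (R → R)) :=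
  fun p =>
    (∀ s : Set L, p.1 (sSup s) = ⨆ l ∈ s, p.1 l) ∧
    (∀ (t : T) (l : L), p.1 (τ.smulL t l) = τ.smulL t (p.1 l)) ∧
    (∀ s : Set R, p.2 (sSup s) = ⨆ r ∈ s, p.2 r) ∧
    (∀ (r : R) (t : T), p.2 (τ.smulR r t) = τ.smulR (p.2 r) t) ∧
    (∀ (l : L) (r : R), τ.pair (p.1 l) r = τ.pair l (p.2 r))

/-- Multiplication on `Q₁`: `(α,β)·(α',β') = (α'∘α, β∘β')`. -/
def q1mul (p q : (L → L) × (R → R)) : (L → L) × (R → R) :=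
  (q.1 ∘ p.1, p.2 ∘ q.2)

/-- `⟨r,l⟩ = (l' ↦ (l'·r)·l, r' ↦ r·(l·r'))`. -/
def Triad.rl (τ : Triad L T R) (r : R) (l : L) : (L → L) × (R → R) :=
  (fun l' => τ.smulL (τ.pair l' r) l, fun r' => τ.smulR r (τ.pair l r'))

/-- The triad is strong if `l ≤ (l·⊤_R)·⊤_L` and `r ≤ ⊤_R·(⊤_L·r)`. -/
def Triad.Strong (τ : Triad L T R) : Prop :=
  (∀ l : L, l ≤ τ.smulL (τ.pair l ⊤) ⊤) ∧ (∀ r : R, r ≤ τ.smulR ⊤ (τ.pair ⊤ r))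

/-- `e` is a unit for the triad: a unit of `T` acting unitally on `L` and `R`. -/
def Triad.IsTriadUnit (τ : Triad L T R) (e : T) : Prop :=
  (∀ t : T, τ.tmul e t = t) ∧ (∀ t : T, τ.tmul t e = t) ∧
  (∀ l : L, τ.smulL e l = l) ∧ (∀ r : R, τ.smulR r e = r)

/-- The triad is strict (with unit `e`): strong, unital, and `⊤_L·⊤_R = e`. -/
def Triad.Strict (τ : Triad L T R) (e : T) : Prop :=
  τ.Strong ∧ τ.IsTriadUnit e ∧ τ.pair ⊤ ⊤ = e

/-- `l^⊥ = ⋁{r : l·r ≤ d}`. -/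
def lperp (τ : Triad L T R) (d : T) (l : L) : R := sSup {r : R | τ.pair l r ≤ d}

/-- `r^⊥ = ⋁{l : l·r ≤ d}`. -/
def rperp (τ : Triad L T R) (d : T) (r : R) : L := sSup {l : L | τ.pair l r ≤ d}

/-- `d` is a Girard element: cyclic, the pairing is represented by the two perps,
and the perps are mutually inverse. -/
def Triad.GirardElem (τ : Triad L T R) (d : T) : Prop :=
  (∀ t t' : T, τ.tmul t t' ≤ d ↔ τ.tmul t' t ≤ d) ∧
  (∀ (l : L) (r : R), τ.pair l r ≤ d ↔ r ≤ lperp τ d l) ∧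
  (∀ (l : L) (r : R), τ.pair l r ≤ d ↔ l ≤ rperp τ d r) ∧
  (∀ l : L, rperp τ d (lperp τ d l) = l) ∧
  (∀ r : R, lperp τ d (rperp τ d r) = r)

theorem map_sup_of_map_sSup {M N : Type*} [CompleteLattice M] [CompleteLattice N] {f : M → N}
    (hf : ∀ s : Set M, f (sSup s) = ⨆ a ∈ s, f a) (a b : M) : f (a ⊔ b) = f a ⊔ f b := by
  rw [← sSup_pair, hf, iSup_pair]

theorem map_bot_of_map_sSup {M N : Type*} [CompleteLattice M] [CompleteLattice N] {f : M → N}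
    (hf : ∀ s : Set M, f (sSup s) = ⨆ a ∈ s, f a) : f ⊥ = ⊥ := by
  rw [← sSup_empty, hf]
  simp

theorem monotone_of_map_sSup {M N : Type*} [CompleteLattice M] [CompleteLattice N] {f : M → N}
    (hf : ∀ s : Set M, f (sSup s) = ⨆ a ∈ s, f a) : Monotone f := fun a b hab => by
  rw [← sup_eq_right.2 hab, map_sup_of_map_sSup hf]
  exact le_sup_left

/-- In a unital module over a complete lattice acting through meets, a complemented scalar `t`
satisfies the distributivity law `(t·⊤ ⊔ m) ⊓ (s·x ⊔ m) = t·x ⊔ m` for all `s ≥ t`. -/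
theorem act_top_sup_inf_act_sup {S M : Type*} [CompleteLattice S] [CompleteLattice M]
    {act : S → M → M}
    (hleft : ∀ (s : Set S) (x : M), act (sSup s) x = ⨆ t ∈ s, act t x)
    (hright : ∀ (t : S) (s : Set M), act t (sSup s) = ⨆ x ∈ s, act t x)
    (hact : ∀ (t s : S) (x : M), act t (act s x) = act (t ⊓ s) x)
    (hone : ∀ x : M, act ⊤ x = x)
    {t u s : S} (htu : IsCompl t u) (hts : t ≤ s) (x m : M) :
    (act t ⊤ ⊔ m) ⊓ (act s x ⊔ m) = act t x ⊔ m := by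
  have hmono (a : S) : Monotone (act a) := monotone_of_map_sSup (hright a)
  have hmono_left (y : M) : Monotone (act · y) := monotone_of_map_sSup (hleft · y)
  have hsup (a : S) (y z : M) : act a (y ⊔ z) = act a y ⊔ act a z :=
    map_sup_of_map_sSup (hright a) y z
  have hle (a : S) (y : M) : act a y ≤ y := (hmono_left y le_top).trans (hone y).le
  apply le_antisymm
  · rw [← hone ((act t ⊤ ⊔ m) ⊓ (act s x ⊔ m)), ← htu.sup_eq_top,
      map_sup_of_map_sSup (f := (act · _)) (hleft · _)]
    refine sup_le ((hmono t inf_le_right).trans ?_) ((hmono u inf_le_left).trans ?_)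
    · rw [hsup, hact, inf_eq_left.2 hts]
      exact sup_le_sup_left (hle t m) _
    · rw [hsup, hact, inf_comm, htu.inf_eq_bot,
        map_bot_of_map_sSup (f := (act · _)) (hleft · _), bot_sup_eq]
      exact (hle u m).trans le_sup_right
  · exact le_inf (sup_le_sup_right (hmono t le_top) _)
      (sup_le_sup_right (hmono_left x hts) _)

/-- In a strict Girard triad, the scalars are separated by their annihilators relative to `d`. -/
theorem Triad.le_of_forall_tmul_le {τ : Triad L T R} {e d : T} (hs : τ.Strict e)
    (hd : τ.GirardElem d) {w t : T} (h : ∀ s, τ.tmul t s ≤ d → τ.tmul w s ≤ d) : w ≤ t := by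
  obtain ⟨-, ⟨-, hmul_e, -, -⟩, htop⟩ := hs
  obtain ⟨-, hlperp, hrperp, hinv, -⟩ := hd
  have hwt : τ.smulL w ⊤ ≤ τ.smulL t ⊤ := by
    rw [← hinv (τ.smulL t ⊤), ← hrperp, τ.smulL_pair]
    apply h
    rw [← τ.smulL_pair, hlperp]
  have hp (a : T) : τ.pair (τ.smulL a ⊤) ⊤ = a := by rw [τ.smulL_pair, htop, hmul_e]
  rw [← hp w, ← hp t]
  exact monotone_of_map_sSup (f := (τ.pair · ⊤)) (τ.pair_sSup_left · ⊤) hwt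

/-- If the multiplication of `T` in a strict Girard triad is the meet, then `T` is
complemented. -/
theorem Triad.exists_isCompl {τ : Triad L T R} {e d : T} (hs : τ.Strict e)
    (hd : τ.GirardElem d) (hmul : ∀ a b : T, τ.tmul a b = a ⊓ b) (t : T) :
    ∃ u, IsCompl t u := by
  have hd_bot : d = ⊥ := le_bot_iff.1 <| le_of_forall_tmul_le hs hd fun s _ => by
    rw [hmul]
    exact inf_le_left
  subst hd_bot
  have hu : τ.tmul t (sSup {s | τ.tmul t s ≤ ⊥}) ≤ ⊥ := by
    rw [τ.tmul_sSup_right]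
    exact iSup₂_le fun _ hs => hs
  refine ⟨_, disjoint_iff_inf_le.2 (hmul _ _ ▸ hu),
    codisjoint_iff_le_sup.2 <| le_of_forall_tmul_le hs hd fun s h => ?_⟩
  rw [hmul] at h ⊢
  have hsu : s ≤ sSup {s | τ.tmul t s ≤ ⊥} := le_sSup <| by
    rw [Set.mem_ofPred_eq, hmul]
    exact (inf_le_inf_right s le_sup_left).trans h
  exact inf_le_right.trans ((le_inf (hsu.trans le_sup_right) le_rfl).trans h)

/-- For a strict Girard triad with `T` distributive
(`(a ⊔ c) ⊓ (b ⊔ c) = a·b ⊔ c`), `Q₁` is distributive: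
`(⟨r,⊤_L⟩ ⊔ q) ⊓ (⟨⊤_R,l⟩ ⊔ q) = ⟨r,l⟩ ⊔ q` for every `q ∈ Q₁`, with joins and
meets componentwise pointwise. -/
theorem stmt13 (τ : Triad L T R) (e : T) (hs : τ.Strict e)
    (d : T) (hd : τ.GirardElem d)
    (hdist : ∀ a b c : T, (a ⊔ c) ⊓ (b ⊔ c) = τ.tmul a b ⊔ c) :
    ∀ q ∈ τ.Q1, ∀ (r : R) (l : L),
      (τ.rl r ⊤ ⊔ q) ⊓ (τ.rl ⊤ l ⊔ q) = τ.rl r l ⊔ q := by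
  intro q _ r l
  have hmul (a b : T) : τ.tmul a b = a ⊓ b := by simpa using (hdist a b ⊥).symm
  have he : e = ⊤ := by
    have h := hs.2.1.1 ⊤
    rwa [hmul, inf_top_eq] at h
  subst he
  have hcompl := Triad.exists_isCompl hs hd hmul
  obtain ⟨-, ⟨-, -, honeL, honeR⟩, -⟩ := hs
  refine Prod.ext (funext fun x => ?_) (funext fun y => ?_)
  · obtain ⟨u, hu⟩ := hcompl (τ.pair x r)
    exact act_top_sup_inf_act_sup τ.smulL_sSup_left τ.smulL_sSup_right
      (fun t s z => by rw [← τ.smulL_assoc, hmul]) honeL hu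
      (monotone_of_map_sSup (τ.pair_sSup_right x) le_top) l (q.1 x)
  · obtain ⟨u, hu⟩ := hcompl (τ.pair l y)
    have h := act_top_sup_inf_act_sup (act := fun t z => τ.smulR z t)
      (fun s z => τ.smulR_sSup_right z s) (fun t s => τ.smulR_sSup_left s t)
      (fun t s z => by rw [τ.smulR_assoc, hmul, inf_comm]) honeR hu
      (monotone_of_map_sSup (f := (τ.pair · y)) (τ.pair_sSup_left · y) le_top) r (q.2 y)
    exact (inf_comm _ _).trans h
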